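/- Let W be an admissible Wilson loop diagram with k propagators and n vertices. The Grassmann necklace (I_1^W, ..., I_n^W) produced by the Grassmann necklace algorithm is the Grassmann necklace of the positroid M(W): for each i ∈ [n], the set I_i^W is a basis of M(W), and every k-subset of [n] that is strictly smaller than I_i^W in the lexicographic order induced by <_i is a dependent set of M(W). -/

import Mathlib

open scoped Classical

namespace WLD

/-- A propagator of a Wilson loop diagram on the cyclically ordered vertex set
`ZMod n` (vertex `n` is identified with `0`): an unordered pair of edges, the
edge joining vertex `i` to vertex `i+1` being labelled `i`. -/
abbrev Prp (n : ℕ) := Sym2 (ZMod n)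

variable (n : ℕ)

/-- The position of `x` in the linear order `i <_i i+1 <_i ⋯ <_i i-1`. -/
def ord (i x : ZMod n) : ℕ := (x - i).val

/-- The other end of a propagator `p` having an end on the edge `e`. -/
noncomputable def otherEnd (p : Prp n) (e : ZMod n) : ZMod n :=
  if h : e ∈ p then Sym2.Mem.other h else e

/-- The vertex support `V(p) = {i, i+1, j, j+1}` of the propagator `p = (i,j)`. -/
def supp (p : Prp n) : Finset (ZMod n) :=
  Sym2.lift ⟨fun i j => {i, i + 1, j, j + 1}, fun i j => by
    ext x
    simp only [Finset.mem_insert, Finset.mem_singleton]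
    tauto⟩ p

/-- The vertex support `V(Q)` of a set of propagators. -/
def suppSet (Q : Finset (Prp n)) : Finset (ZMod n) := Q.biUnion (supp n)

/-- `Prop(U)`: the propagators of `P` supported on (a vertex of) `U`. -/
noncomputable def propsOn (P : Finset (Prp n)) (U : Finset (ZMod n)) : Finset (Prp n) :=
  P.filter fun p => (supp n p ∩ U).Nonempty

/-- Two propagators `p = (i,j)` and `q = (k,l)` cross if `i < k < j < l` cyclically. -/
def Crossing (p q : Prp n) : Prop :=
  ∃ i j k l : ZMod n, p = s(i, j) ∧ q = s(k, l) ∧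
    0 < ord n i k ∧ ord n i k < ord n i j ∧ ord n i j < ord n i l

/-- Weak admissibility of a Wilson loop diagram. -/
structure IsWeaklyAdmissible (P : Finset (Prp n)) : Prop where
  dense : ∀ Q ⊆ P, Q.Nonempty → Q.card + 3 ≤ (suppSet n Q).card
  noncross : ∀ p ∈ P, ∀ q ∈ P, ¬ Crossing n p q

/-- Admissibility of a Wilson loop diagram. -/
structure IsAdmissible (P : Finset (Prp n)) : Prop where
  card_add_four_le : P.card + 4 ≤ n
  dense : ∀ Q ⊆ P, Q.Nonempty → Q.card + 3 ≤ (suppSet n Q).card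
  noncross : ∀ p ∈ P, ∀ q ∈ P, ¬ Crossing n p q

/-- The length of a propagator `p = (i,j)`:
`min(|[i+1, j]|, |[j+1, i]|)`, the number of vertices on its smaller side. -/
def plength (p : Prp n) : ℕ :=
  Sym2.lift ⟨fun i j => min ((j - i - 1).val + 1) ((i - j - 1).val + 1),
    fun _ _ => min_comm _ _⟩ p

/-- `InsideDir n i p q` : the propagator `q = (k,l)` lies (weakly) inside the
propagator `p = (i,j)` directed from its end `i`, i.e. `i ≤_i k <_i l ≤_i j`. -/
def InsideDir (i : ZMod n) (p q : Prp n) : Prop :=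
  ∃ j k l : ZMod n, p = s(i, j) ∧ q = s(k, l) ∧
    ord n i k < ord n i l ∧ ord n i l ≤ ord n i j

/-- Sorting key measuring how far clockwise of the vertex `a` the relevant end of
a propagator supported on `a` is attached: ends on the edge `a-1` are clockwise of
ends on the edge `a`, and on a fixed edge an end is the more clockwise the larger
the propagator is (nestedness of noncrossing propagators sharing an edge). -/
noncomputable def cwKey (a : ZMod n) (p : Prp n) : ℕ :=
  if a - 1 ∈ p then n + ord n (a - 1) (otherEnd n p (a - 1))
  else ord n a (otherEnd n p a)

/-- The clockwise-most propagator of `S` supported on the vertex `a`, if any. -/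
noncomputable def pickCW (S : Finset (Prp n)) (a : ZMod n) : Option (Prp n) :=
  if h : (S.filter fun p => a ∈ supp n p).Nonempty then
    some (Classical.choose
      ((S.filter fun p => a ∈ supp n p).exists_max_image (cwKey n a) h))
  else none

/-- The Grassmann necklace algorithm started at the vertex `i`: after `t` steps,
`(gnRun n P i t).1` is the set of propagators not yet deleted, and
`(gnRun n P i t).2` records the vertex assigned to each deleted propagator.
Step `t+1` processes the vertex `i + t`: if some not-yet-deleted propagator is
supported on it, the clockwise-most such propagator is deleted and assigned
that vertex. -/
noncomputable def gnRun (P : Finset (Prp n)) (i : ZMod n) :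
    ℕ → Finset (Prp n) × (Prp n → Option (ZMod n))
  | 0 => (P, fun _ => none)
  | t + 1 =>
    match pickCW n (gnRun P i t).1 (i + (t : ZMod n)) with
    | none => gnRun P i t
    | some p => ((gnRun P i t).1.erase p,
        Function.update (gnRun P i t).2 p (some (i + (t : ZMod n))))

/-- `I_i^W(p)`: the vertex contributed by the propagator `p` to the Grassmann
necklace term `I_i^W` (as an `Option`; the algorithm makes one full circuit of
the vertex set, i.e. runs for `n` steps). -/
noncomputable def gnAssign (P : Finset (Prp n)) (i : ZMod n) (p : Prp n) :
    Option (ZMod n) :=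
  (gnRun n P i n).2 p

/-- The Grassmann necklace term `I_i^W` produced by the algorithm. -/
noncomputable def gnSet [NeZero n] (P : Finset (Prp n)) (i : ZMod n) :
    Finset (ZMod n) :=
  Finset.univ.filter fun v => ∃ p, gnAssign n P i p = some v

/-- The cyclic interval `{a, a+1, …, a + (len-1)}` in `ZMod n`. -/
def cInterval [NeZero n] (a : ZMod n) (len : ℕ) : Finset (ZMod n) :=
  Finset.univ.filter fun x => ord n a x < len

/-- A Grassmann necklace of type `(k, n)`: a cyclic sequence of `k`-element
subsets of the vertex set such that `I_{i+1} = (I_i \ {i}) ∪ {j}` for some `j`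
whenever `i ∈ I_i`, and `I_{i+1} = I_i` otherwise. -/
def IsGrassmannNecklace [NeZero n] (k : ℕ) (I : ZMod n → Finset (ZMod n)) : Prop :=
  (∀ i, (I i).card = k) ∧
  ∀ i : ZMod n,
    (i ∈ I i → ∃ j : ZMod n, I (i + 1) = insert j ((I i).erase i)) ∧
    (i ∉ I i → I (i + 1) = I i)

/-- Independence in the matroid `M(W)`: no subset `U` of `J` supports fewer
propagators than the vertices it contains. -/
def Indep (P : Finset (Prp n)) (J : Finset (ZMod n)) : Prop :=
  ∀ U ⊆ J, U.card ≤ (propsOn n P U).card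

/-- `A` is lexicographically smaller than `B` with respect to the order `<_i`:
the `<_i`-least element of the symmetric difference lies in `A`. -/
def LexLt (i : ZMod n) (A B : Finset (ZMod n)) : Prop :=
  ∃ v, v ∈ A ∧ v ∉ B ∧ ∀ w, ord n i w < ord n i v → (w ∈ A ↔ w ∈ B)

/-- A `+` is placed in the box `(a, b)` of the Le diagram with row labels `I₁`
by the necklace term `Ii`: writing `I₁ \ Ii = {a₁ > ⋯ > a_r}` and
`Ii \ I₁ = {b₁ < ⋯ < b_r}` in the `<₁` order, the plusses are in the boxes
`(a_t, b_t)`. -/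
def LePlusAt (I₁ Ii : Finset (ZMod n)) (a b : ZMod n) : Prop :=
  a ∈ I₁ \ Ii ∧ b ∈ Ii \ I₁ ∧
    ((I₁ \ Ii).filter fun x => ord n 1 a < ord n 1 x).card =
      ((Ii \ I₁).filter fun y => ord n 1 y < ord n 1 b).card

/-- The box `(a, b)` of the Le diagram of the diagram `P` contains a `+`. -/
def LePlus [NeZero n] (P : Finset (Prp n)) (a b : ZMod n) : Prop :=
  ∃ i : ZMod n, LePlusAt n (gnSet n P 1) (gnSet n P i) a b

/-- The number of `+` entries in the Le diagram of the diagram `P`. -/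
noncomputable def plusCount [NeZero n] (P : Finset (Prp n)) : ℕ :=
  (Finset.univ.filter fun ab : ZMod n × ZMod n => LePlus n P ab.1 ab.2).card

/-- The length of the row labelled `a` of the Young diagram with row labels `I₁`
(the boxes of row `a` are indexed by the column labels `b ∉ I₁` with `a <₁ b`). -/
noncomputable def rowLen [NeZero n] (I₁ : Finset (ZMod n)) (a : ZMod n) : ℕ :=
  (Finset.univ.filter fun b => b ∉ I₁ ∧ ord n 1 a < ord n 1 b).card

/-- The entry of the matrix `C(W)` in row `p` and column `q`: the indeterminate
`x_{p,q}` if `q ∈ V(p)`, and `0` otherwise. -/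
noncomputable def CW (p : Prp n) (q : ZMod n) : MvPolynomial (Prp n × ZMod n) ℝ :=
  if q ∈ supp n p then MvPolynomial.X (p, q) else 0

/-- The column paired with the row `p` in the minors determined by `I_i^W`. -/
noncomputable def colOf (P : Finset (Prp n)) (i : ZMod n) (p : Prp n) : ZMod n :=
  (gnAssign n P i p).getD i

/-- `Δ_{I_i}`: the determinant of the `k × k` minor of `C(W)` on the columns
indexed by `I_i^W`, rows and columns paired via the necklace assignment. -/
noncomputable def Delta (P : Finset (Prp n)) (i : ZMod n) :
    MvPolynomial (Prp n × ZMod n) ℝ :=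
  Matrix.det (Matrix.of fun p q : ↥P => CW n (p : Prp n) (colOf n P i (q : Prp n)))

/-- `S_i`: the propagators whose contribution changes from `I_{i-1}` to `I_i`. -/
noncomputable def Schanged (P : Finset (Prp n)) (i : ZMod n) : Finset (Prp n) :=
  P.filter fun p => gnAssign n P (i - 1) p ≠ gnAssign n P i p

/-- `r_i`: the determinant of the minor of `C(W)` with rows indexed by `S_i` and
columns indexed by `I_i(S_i)` (equal to `1` when `S_i = ∅`). -/
noncomputable def rfac (P : Finset (Prp n)) (i : ZMod n) :
    MvPolynomial (Prp n × ZMod n) ℝ :=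
  Matrix.det
    (Matrix.of fun p q : ↥(Schanged n P i) => CW n (p : Prp n) (colOf n P i (q : Prp n)))

/-- `R = ∏ᵢ rᵢ`, the polynomial produced by the algorithm. -/
noncomputable def Rpoly [NeZero n] (P : Finset (Prp n)) :
    MvPolynomial (Prp n × ZMod n) ℝ :=
  ∏ i : ZMod n, rfac n P i

/-- Position of the end of the propagator `p` along the edge `e`: larger values
attach closer to the vertex `e`, i.e. earlier in the counterclockwise ordering
of the ends of propagators along the edge `e`. -/
noncomputable def edgeKey (e : ZMod n) (p : Prp n) : ℕ := ord n e (otherEnd n p e)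

/-- The propagators of `P` with an end on the edge `e`. -/
noncomputable def onEdge (P : Finset (Prp n)) (e : ZMod n) : Finset (Prp n) :=
  P.filter fun p => e ∈ p

/-- `p` is the first propagator (`p₁`) on the edge `e` in the counterclockwise
ordering of the propagators with an end on the edge `e`. -/
def IsCcwFirst (P : Finset (Prp n)) (e : ZMod n) (p : Prp n) : Prop :=
  p ∈ onEdge n P e ∧ ∀ q ∈ onEdge n P e, edgeKey n e q ≤ edgeKey n e p

/-- `p` is the last propagator (`p_r`) on the edge `e` in the counterclockwise
ordering of the propagators with an end on the edge `e`. -/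
def IsCcwLast (P : Finset (Prp n)) (e : ZMod n) (p : Prp n) : Prop :=
  p ∈ onEdge n P e ∧ ∀ q ∈ onEdge n P e, edgeKey n e p ≤ edgeKey n e q

/-- `p` and `q` are consecutive, in this order (`p = p_j`, `q = p_{j+1}`), in the
counterclockwise ordering of the propagators with an end on the edge `e`. -/
def ConsecOnEdge (P : Finset (Prp n)) (e : ZMod n) (p q : Prp n) : Prop :=
  p ∈ onEdge n P e ∧ q ∈ onEdge n P e ∧ edgeKey n e q < edgeKey n e p ∧
    ∀ r ∈ onEdge n P e, ¬ (edgeKey n e q < edgeKey n e r ∧ edgeKey n e r < edgeKey n e p)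

/-- The factor `R_e` of the denominator `R(W)` associated to the edge `e`:
`R_e = x_{p₁,e+1} • ∏_{j=1}^{r-1} (x_{p_j,e} x_{p_{j+1},e+1} - x_{p_{j+1},e} x_{p_j,e+1}) • x_{p_r,e}`
for the counterclockwise ordering `p₁, …, p_r` of the propagators on the edge `e`
(`R_e = 1` if there are none). -/
noncomputable def Redge (P : Finset (Prp n)) (e : ZMod n) :
    MvPolynomial (Prp n × ZMod n) ℝ :=
  (∏ p ∈ (onEdge n P e).filter (IsCcwFirst n P e), MvPolynomial.X (p, e + 1)) *
    (∏ pq ∈ (P ×ˢ P).filter (fun pq => ConsecOnEdge n P e pq.1 pq.2),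
      (MvPolynomial.X (pq.1, e) * MvPolynomial.X (pq.2, e + 1) -
        MvPolynomial.X (pq.2, e) * MvPolynomial.X (pq.1, e + 1))) *
    (∏ p ∈ (onEdge n P e).filter (IsCcwLast n P e), MvPolynomial.X (p, e))

/-- The denominator `R(W) = ∏ₑ R_e` of the integrand `Ω(W)`. -/
noncomputable def RW [NeZero n] (P : Finset (Prp n)) :
    MvPolynomial (Prp n × ZMod n) ℝ :=
  ∏ e : ZMod n, Redge n P e

/-- The relabelling map associated to the removal of the vertex `i` from the
vertex set `ZMod n`: the vertex of `ZMod (n-1)` in position `t` (in the `<₁`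
order) is sent to the vertex of `ZMod n` in position `t` if `t` precedes the
position of `i`, and to the vertex in position `t+1` otherwise. -/
noncomputable def liftVert (i : ZMod n) (x : ZMod (n - 1)) : ZMod n :=
  1 + ((if ord (n - 1) 1 x < ord n 1 i then ord (n - 1) 1 x
        else ord (n - 1) 1 x + 1 : ℕ) : ZMod n)

end WLD

namespace WLD

/-- A propagator with ends on the edges `l p` and `r p` is supported on the vertex `t`, in
coordinates where the vertex `t` bounds the edges `t` and `t + 1`, modulo `n`. -/
def Touches {α : Type*} (n : ℕ) (l r : α → ℕ) (p : α) (t : ℕ) : Prop :=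
  (l p = t ∨ r p = t) ∨ (l p = t + 1 ∨ r p = t + 1) ∨ (t + 1 = n ∧ l p = 0)

/-- The propagator `p` has not been picked before time `t`. -/
def Remains {α : Type*} (P : Finset α) (pk : ℕ → Option α) (t : ℕ) (p : α) : Prop :=
  p ∈ P ∧ ∀ u < t, pk u ≠ some p

/-- A run of the necklace algorithm in linear coordinates: `pk t` is the propagator picked at
the vertex `t`. -/
structure LinearRun {α : Type*} (n : ℕ) (P : Finset α) (l r : α → ℕ)
    (pk : ℕ → Option α) : Prop where
  lt : ∀ p ∈ P, r p < n
  nonadj : ∀ p ∈ P, l p + 1 < r p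
  noncross : ∀ p ∈ P, ∀ q ∈ P, ¬ (l p < l q ∧ l q < r p ∧ r p < r q)
  dense : ∀ Q ⊆ P, Q.Nonempty →
    Q.card + 3 ≤ ((Finset.range n).filter fun t => ∃ p ∈ Q, Touches n l r p t).card
  of_none : ∀ t < n, pk t = none → ∀ p, Remains P pk t p → ¬ Touches n l r p t
  remains_of_some : ∀ t < n, ∀ q, pk t = some q → Remains P pk t q
  touches_of_some : ∀ t < n, ∀ q, pk t = some q → Touches n l r q t
  edge_pref : ∀ t < n, ∀ q p, pk t = some q → Remains P pk t p →
    (l p = t ∨ r p = t) → (l q = t ∨ r q = t)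
  left_pref : ∀ t < n, ∀ q p, pk t = some q → Remains P pk t p →
    l p = l q → (l p = t ∨ l p = t + 1) → r p ≤ r q
  right_pref : ∀ t < n, ∀ q p, pk t = some q → Remains P pk t p →
    (r p = t ∨ (r p = t + 1 ∧ ¬ (l q = t ∨ r q = t))) → (l q = r p ∨ r q = r p) →
    r q = r p ∧ l p ≤ l q

namespace LinearRun

variable {α : Type*} {n : ℕ} {P : Finset α} {l r : α → ℕ} {pk : ℕ → Option α}

lemma eq_of_some (h : LinearRun n P l r pk) {t u : ℕ} {p : α} (ht : t < n) (hu : u < n)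
    (htp : pk t = some p) (hup : pk u = some p) : t = u := by
  rcases lt_trichotomy t u with hlt | rfl | hlt
  · exact absurd htp ((h.remains_of_some u hu p hup).2 t hlt)
  · rfl
  · exact absurd hup ((h.remains_of_some t ht p htp).2 u hlt)

/-- If `q` is picked at `u` and supported on `w > u`, then a propagator supported on `[u, w]`
which is still present at `w` is supported on `w`. -/
lemma touches_of_remains (h : LinearRun n P l r pk) {u w t : ℕ} {p q : α} (hw : w < n)
    (hdone : ∀ d < w, ∀ p ∈ P, r p = d → ¬ Remains P pk (d + 1) p)
    (hq : pk u = some q) (huw : u < w) (hqw : Touches n l r q w)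
    (hut : u ≤ t) (htw : t ≤ w) (hp : Touches n l r p t) (hrem : Remains P pk w p) :
    Touches n l r p w := by
  by_contra hpw
  have hun : u < n := huw.trans hw
  have hP := hrem.1
  have hqP := (h.remains_of_some u hun q hq).1
  have hremu : Remains P pk u p := ⟨hP, fun x hx => hrem.2 x (hx.trans huw)⟩
  have hd : w ≤ r p := by
    by_contra! hlt
    exact hdone _ hlt p hP rfl ⟨hP, fun x hx => hrem.2 x (by omega)⟩
  have e := h.edge_pref u hun q p hq hremu
  have lp := h.left_pref u hun q p hq hremu
  have nc := h.noncross q hqP p hP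
  have h1 := h.lt p hP
  have h2 := h.lt q hqP
  have h3 := h.nonadj p hP
  have h4 := h.nonadj q hqP
  have hqu := h.touches_of_some u hun q hq
  unfold Touches at hqw hp hpw hqu
  omega

/-- A vertex at which nothing is picked ends an interval `[s, v]` all of whose propagators
are picked inside the interval. -/
lemma exists_blocked (h : LinearRun n P l r pk) {v : ℕ} (hv : v < n)
    (hdone : ∀ d < v, ∀ p ∈ P, r p = d → ¬ Remains P pk (d + 1) p)
    (hnone : pk v = none) :
    ∃ s ≤ v, ∀ t, s ≤ t → t ≤ v → ∀ p ∈ P, Touches n l r p t →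
      ∃ u, s ≤ u ∧ u < v ∧ pk u = some p := by
  classical
  have hex : ∃ s, s ≤ v ∧ ∀ t, s ≤ t → t ≤ v → ∀ p, Touches n l r p t → ¬ Remains P pk v p := by
    refine ⟨v, le_rfl, fun t h1 h2 p hp hr => ?_⟩
    obtain rfl : t = v := by omega
    exact h.of_none t hv hnone p hr hp
  obtain ⟨hsv, hs⟩ := Nat.find_spec hex
  refine ⟨Nat.find hex, hsv, fun t hst htv p hpP hp => ?_⟩
  have hnr := hs t hst htv p hp
  have : ∃ u < v, pk u = some p := by
    by_contra! hc
    exact hnr ⟨hpP, hc⟩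
  obtain ⟨u, huv, hu⟩ := this
  refine ⟨u, ?_, huv, hu⟩
  by_contra! hus
  refine Nat.find_min hex hus ⟨huv.le, fun t' h1 h2 p' hp' hr' => ?_⟩
  by_cases ht' : t' ≤ t
  · have hr'' : Remains P pk t p' := ⟨hr'.1, fun x hx => hr'.2 x (by omega)⟩
    have := h.touches_of_remains (by omega) (fun d hd => hdone d (by omega)) hu (by omega) hp
      h1 ht' hp' hr''
    exact hs t hst htv p' this hr'
  · exact hs t' (by omega) h2 p' hp' hr'

/-- Every propagator has been picked once its last vertex is processed. -/
lemma not_remains (h : LinearRun n P l r pk) :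
    ∀ b, ∀ p ∈ P, r p = b → ¬ Remains P pk (b + 1) p := by
  classical
  intro b
  induction b using Nat.strong_induction_on with
  | _ b ih =>
  intro p hpP hpb hrem
  have hbn := h.lt p hpP
  have hadj := h.nonadj p hpP
  set B : ℕ → Prop := fun t => ∃ s v, s ≤ t ∧ t ≤ v ∧ v ≤ b ∧
    ∀ t, s ≤ t → t ≤ v → ∀ q ∈ P, Touches n l r q t → ∃ u, s ≤ u ∧ u < v ∧ pk u = some q
  set Q := P.filter fun q => (l p ≤ l q ∧ r q ≤ r p) ∧ ∀ t, Touches n l r q t → ¬ B t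
  have hpQ : p ∈ Q := by
    refine Finset.mem_filter.2 ⟨hpP, by simp, ?_⟩
    rintro t ht ⟨s, v, hst, htv, hvb, hsv⟩
    obtain ⟨u, -, huv, hu⟩ := hsv t hst htv p hpP ht
    exact hrem.2 u (by omega) hu
  have hdense := h.dense Q (Finset.filter_subset _ _) ⟨p, hpQ⟩
  set V := (Finset.range n).filter fun t => ∃ p ∈ Q, Touches n l r p t
  have hpick : ∀ t ∈ V.filter (fun t => l p < t ∧ t ≤ b), ∃ q ∈ Q.erase p, pk t = some q := by
    intro t ht
    obtain ⟨htV, hat, htb⟩ := Finset.mem_filter.1 ht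
    obtain ⟨htn, q', hq'Q, hq't⟩ := Finset.mem_filter.1 htV
    have htn : t < n := Finset.mem_range.1 htn
    have hBt : ¬ B t := (Finset.mem_filter.1 hq'Q).2.2 t hq't
    rcases hq : pk t with _ | q
    · refine absurd ?_ hBt
      obtain ⟨s, hs, hs'⟩ := h.exists_blocked htn (fun d hd => ih d (by omega)) hq
      exact ⟨s, t, hs, le_rfl, htb, hs'⟩
    · have hqr := h.remains_of_some t htn q hq
      have hqt := h.touches_of_some t htn q hq
      have hpr : Remains P pk t p := ⟨hpP, fun x hx => hrem.2 x (by omega)⟩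
      have hqp : q ≠ p := fun hqp => hrem.2 t (by omega) (hqp ▸ hq)
      refine ⟨q, Finset.mem_erase.2 ⟨hqp, Finset.mem_filter.2 ⟨hqr.1, ?_, ?_⟩⟩, rfl⟩
      · have e := h.edge_pref t htn q p hq hpr
        have rp := h.right_pref t htn q p hq hpr
        have nc := h.noncross q hqr.1 p hpP
        have nc' := h.noncross p hpP q hqr.1
        have h2 := h.lt q hqr.1
        have h4 := h.nonadj q hqr.1
        unfold Touches at hqt
        omega
      · rintro t' ht' ⟨s, v, hst, htv, hvb, hsv⟩
        obtain ⟨u, hsu, huv, hu⟩ := hsv t' hst htv q hqr.1 ht'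
        obtain rfl := h.eq_of_some htn (by omega) hq hu
        exact hBt ⟨s, v, hsu, huv.le, hvb, hsv⟩
  have hcard : (V.filter (fun t => l p < t ∧ t ≤ b)).card ≤ (Q.erase p).card := by
    have : Nonempty α := ⟨p⟩
    choose! f hf using hpick
    refine Finset.card_le_card_of_injOn f (fun t ht => (hf t ht).1) fun t ht t' ht' htt' => ?_
    have h1 := Finset.mem_range.1 (Finset.mem_filter.1 (Finset.mem_filter.1 ht).1).1
    have h2 := Finset.mem_range.1 (Finset.mem_filter.1 (Finset.mem_filter.1 ht').1).1
    exact h.eq_of_some h1 h2 (hf t ht).2 (htt' ▸ (hf t' ht').2)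
  have hsub : V ⊆ V.filter (fun t => l p < t ∧ t ≤ b) ∪
      {l p, if l p = 0 then n - 1 else l p - 1} := by
    intro t ht
    obtain ⟨htn, q, hqQ, hqt⟩ := Finset.mem_filter.1 ht
    obtain ⟨hqP, hq, -⟩ := Finset.mem_filter.1 hqQ
    have h4 := h.nonadj q hqP
    simp only [Finset.mem_union, Finset.mem_filter, ht, true_and, Finset.mem_insert,
      Finset.mem_singleton]
    unfold Touches at hqt
    split_ifs <;> omega
  have h1 := (Finset.card_le_card hsub).trans (Finset.card_union_le _ _)
  have h2 := Finset.card_le_two (a := l p) (b := if l p = 0 then n - 1 else l p - 1)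
  have h3 := Finset.card_erase_lt_of_mem hpQ
  omega

lemma exists_pick (h : LinearRun n P l r pk) {p : α} (hp : p ∈ P) :
    ∃ t < n, pk t = some p := by
  have := h.not_remains _ p hp rfl
  have hlt := h.lt p hp
  by_contra! hc
  exact this ⟨hp, fun u hu => hc u (by omega)⟩

end LinearRun
end WLD

namespace WLD

section Coordinates

variable {n : ℕ}

lemma ord_lt [NeZero n] (i x : ZMod n) : ord n i x < n := ZMod.val_lt _

lemma ord_injective [NeZero n] (i : ZMod n) : Function.Injective (ord n i) := fun x y h => by
  simpa using ZMod.val_injective n h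

lemma ord_add_natCast (i : ZMod n) {t : ℕ} (ht : t < n) : ord n i (i + t) = t := by
  simp [ord, ZMod.val_cast_of_lt ht]

lemma add_ord [NeZero n] (i x : ZMod n) : i + (ord n i x : ZMod n) = x := by
  simp [ord]

lemma ord_eq [NeZero n] (c x y : ZMod n) :
    ord n x y = if ord n c x ≤ ord n c y then ord n c y - ord n c x
      else n + ord n c y - ord n c x := by
  have h : y - x = (y - c) - (x - c) := by ring
  unfold ord
  rw [h]
  split_ifs with hle
  · exact ZMod.val_sub hle
  · push Not at hle
    rw [← neg_sub, ZMod.neg_val, ZMod.val_sub hle.le, if_neg]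
    · have := ZMod.val_lt (x - c)
      omega
    · intro h0
      rw [sub_eq_zero.1 h0] at hle
      exact lt_irrefl _ hle

lemma ord_pred_sub_one (i : ZMod n) {t : ℕ} (ht : t < n) : ord n (i - 1) (i + t - 1) = t := by
  rw [show i + (t : ZMod n) - 1 = (i - 1) + t by ring, ord_add_natCast _ ht]

lemma ord_pred_add (i : ZMod n) {t : ℕ} (ht : t + 1 < n) : ord n (i - 1) (i + t) = t + 1 := by
  rw [show i + (t : ZMod n) = (i - 1) + (t + 1 : ℕ) by push_cast; ring, ord_add_natCast _ ht]

lemma ord_pred_add_last (i : ZMod n) {t : ℕ} (ht : t + 1 = n) : ord n (i - 1) (i + t) = 0 := by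
  rw [ord, show i + (t : ZMod n) - (i - 1) = ((t + 1 : ℕ) : ZMod n) by push_cast; ring, ht]
  simp

/-- The end of the propagator `p` closer to the edge `i - 1`, as a position counted from it. -/
def lo (i : ZMod n) (p : Prp n) : ℕ :=
  Sym2.lift ⟨fun x y => min (ord n (i - 1) x) (ord n (i - 1) y), fun _ _ => min_comm _ _⟩ p

/-- The end of the propagator `p` farther from the edge `i - 1`, as a position counted from it. -/
def hi (i : ZMod n) (p : Prp n) : ℕ :=
  Sym2.lift ⟨fun x y => max (ord n (i - 1) x) (ord n (i - 1) y), fun _ _ => max_comm _ _⟩ p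

lemma lo_mk (i x y : ZMod n) : lo i s(x, y) = min (ord n (i - 1) x) (ord n (i - 1) y) := rfl

lemma hi_mk (i x y : ZMod n) : hi i s(x, y) = max (ord n (i - 1) x) (ord n (i - 1) y) := rfl

lemma eq_mk_lo_hi [NeZero n] (i : ZMod n) (p : Prp n) : p = s(i - 1 + lo i p, i - 1 + hi i p) := by
  induction p using Sym2.ind with
  | _ x y =>
  rw [lo_mk, hi_mk]
  rcases le_total (ord n (i - 1) x) (ord n (i - 1) y) with h | h
  · simp [h, add_ord]
  · simp [h, add_ord, Sym2.eq_swap]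

lemma hi_lt [NeZero n] (i : ZMod n) (p : Prp n) : hi i p < n := by
  induction p using Sym2.ind with
  | _ x y => exact max_lt (ord_lt _ _) (ord_lt _ _)

lemma lo_le_hi (i : ZMod n) (p : Prp n) : lo i p ≤ hi i p := by
  induction p using Sym2.ind with
  | _ x y => exact min_le_max

lemma mem_iff [NeZero n] (i : ZMod n) (p : Prp n) (e : ZMod n) :
    e ∈ p ↔ lo i p = ord n (i - 1) e ∨ hi i p = ord n (i - 1) e := by
  induction p using Sym2.ind with
  | _ x y =>
  rw [lo_mk, hi_mk, Sym2.mem_iff, ← (ord_injective (i - 1)).eq_iff,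
    ← (ord_injective (i - 1)).eq_iff (a := e)]
  omega

lemma ord_otherEnd [NeZero n] (i : ZMod n) (p : Prp n) (e : ZMod n) (he : e ∈ p) :
    ord n (i - 1) e + ord n (i - 1) (otherEnd n p e) = lo i p + hi i p := by
  have h : s(e, otherEnd n p e) = p := by
    rw [otherEnd, dif_pos he]
    exact Sym2.other_spec he
  conv_rhs => rw [← h, lo_mk, hi_mk]
  exact (min_add_max _ _).symm

lemma mem_supp_iff_mem (p : Prp n) (v : ZMod n) : v ∈ supp n p ↔ v - 1 ∈ p ∨ v ∈ p := by
  induction p using Sym2.ind with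
  | _ x y =>
  simp only [supp, Sym2.lift_mk, Finset.mem_insert, Finset.mem_singleton, Sym2.mem_iff,
    sub_eq_iff_eq_add]
  tauto

lemma mem_supp_iff [NeZero n] (i : ZMod n) (p : Prp n) {t : ℕ} (ht : t < n) :
    i + (t : ZMod n) ∈ supp n p ↔ Touches n (lo i) (hi i) p t := by
  have h1 := hi_lt i p
  have h2 := lo_le_hi i p
  rw [mem_supp_iff_mem, mem_iff i, mem_iff i, ord_pred_sub_one i ht, Touches]
  rcases Nat.lt_or_ge (t + 1) n with h | h
  · rw [ord_pred_add i h]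
    omega
  · rw [ord_pred_add_last i (by omega)]
    omega

lemma cwKey_of_edge [NeZero n] (i : ZMod n) (p : Prp n) {t : ℕ} (ht : t < n)
    (hp : lo i p = t ∨ hi i p = t) :
    cwKey n (i + t) p = if lo i p = t then n + (hi i p - t) else n + (n + lo i p - t) := by
  have h2 := lo_le_hi i p
  have hm : i + (t : ZMod n) - 1 ∈ p := by rwa [mem_iff i, ord_pred_sub_one i ht]
  have ho := ord_otherEnd i p _ hm
  rw [cwKey, if_pos hm, ord_eq (i - 1), ord_pred_sub_one i ht]
  rw [ord_pred_sub_one i ht] at ho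
  split_ifs <;> omega

lemma cwKey_of_not_edge [NeZero n] (i : ZMod n) (p : Prp n) {t : ℕ} (ht : t + 1 < n)
    (hp : ¬ (lo i p = t ∨ hi i p = t)) (hp' : lo i p = t + 1 ∨ hi i p = t + 1) :
    cwKey n (i + t) p =
      if lo i p = t + 1 then hi i p - (t + 1) else n + lo i p - (t + 1) := by
  have h2 := lo_le_hi i p
  have hm : ¬ i + (t : ZMod n) - 1 ∈ p := by rwa [mem_iff i, ord_pred_sub_one i (by omega)]
  have hm' : i + (t : ZMod n) ∈ p := by rwa [mem_iff i, ord_pred_add i ht]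
  have ho := ord_otherEnd i p _ hm'
  rw [cwKey, if_neg hm, ord_eq (i - 1), ord_pred_add i ht]
  rw [ord_pred_add i ht] at ho
  split_ifs <;> omega

lemma cwKey_lt_of_not_edge [NeZero n] (i : ZMod n) (p : Prp n) {t : ℕ} (ht : t < n)
    (hp : ¬ (lo i p = t ∨ hi i p = t)) : cwKey n (i + t) p < n := by
  have hm : ¬ i + (t : ZMod n) - 1 ∈ p := by rwa [mem_iff i, ord_pred_sub_one i ht]
  rw [cwKey, if_neg hm]
  exact ord_lt _ _

end Coordinates

section Admissible

variable {n : ℕ} [NeZero n] {P : Finset (Prp n)}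

lemma lo_add_one_lt_hi (hadm : IsAdmissible n P) (i : ZMod n) {p : Prp n} (hp : p ∈ P) :
    lo i p + 1 < hi i p := by
  have hd := hadm.dense {p} (by simpa using hp) (by simp)
  have hle := lo_le_hi i p
  by_contra! hlt
  have h3 : (suppSet n {p}).card ≤ 3 := by
    rw [suppSet, Finset.singleton_biUnion, eq_mk_lo_hi i p, supp, Sym2.lift_mk]
    obtain h | h : hi i p = lo i p ∨ hi i p = lo i p + 1 := by omega
    all_goals
      rw [h]
      push_cast
      refine le_trans (Finset.card_le_card ?_)
        (Finset.card_le_three (a := i - 1 + (lo i p : ZMod n)) (b := i - 1 + (lo i p : ZMod n) + 1)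
          (c := i - 1 + (lo i p : ZMod n) + 1 + 1))
      intro z
      simp only [Finset.mem_insert, Finset.mem_singleton, ← add_assoc]
      tauto
  simp only [Finset.card_singleton] at hd
  omega

lemma not_lo_hi_interleave (hadm : IsAdmissible n P) (i : ZMod n) {p q : Prp n}
    (hp : p ∈ P) (hq : q ∈ P) : ¬ (lo i p < lo i q ∧ lo i q < hi i p ∧ hi i p < hi i q) := by
  rintro ⟨h1, h2, h3⟩
  have h4 := hi_lt i q
  refine hadm.noncross p hp q hq ⟨_, _, _, _, eq_mk_lo_hi i p, eq_mk_lo_hi i q, ?_, ?_, ?_⟩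
  all_goals
    simp only [ord_eq (i - 1) (i - 1 + (lo i p : ZMod n))]
    rw [ord_add_natCast, ord_add_natCast]
    try rw [ord_add_natCast]
    all_goals try split_ifs
    all_goals omega

lemma card_suppSet (i : ZMod n) (Q : Finset (Prp n)) :
    (suppSet n Q).card =
      ((Finset.range n).filter fun t => ∃ p ∈ Q, Touches n (lo i) (hi i) p t).card := by
  refine Finset.card_bij (fun v _ => ord n i v) (fun v hv => ?_)
    (fun v _ w _ h => ord_injective i h) (fun t ht => ?_)
  · obtain ⟨p, hp, hv⟩ := Finset.mem_biUnion.1 hv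
    refine Finset.mem_filter.2 ⟨Finset.mem_range.2 (ord_lt _ _), p, hp, ?_⟩
    rwa [← mem_supp_iff i p (ord_lt _ _), add_ord]
  · obtain ⟨htn, p, hp, ht⟩ := Finset.mem_filter.1 ht
    have htn := Finset.mem_range.1 htn
    exact ⟨i + t, Finset.mem_biUnion.2 ⟨p, hp, (mem_supp_iff i p htn).2 ht⟩,
      ord_add_natCast i htn⟩

end Admissible

section Run

variable {n : ℕ} {P S : Finset (Prp n)} {i a : ZMod n}

lemma of_pickCW_eq_some {q : Prp n} (h : pickCW n S a = some q) :
    q ∈ S ∧ a ∈ supp n q ∧ ∀ p ∈ S, a ∈ supp n p → cwKey n a p ≤ cwKey n a q := by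
  unfold pickCW at h
  split_ifs at h with hne
  have hs := Classical.choose_spec
    ((S.filter fun p => a ∈ supp n p).exists_max_image (cwKey n a) hne)
  rw [Option.some.inj h] at hs
  exact ⟨(Finset.mem_filter.1 hs.1).1, (Finset.mem_filter.1 hs.1).2,
    fun p hp hap => hs.2 p (Finset.mem_filter.2 ⟨hp, hap⟩)⟩

lemma of_pickCW_eq_none (h : pickCW n S a = none) : ∀ p ∈ S, a ∉ supp n p := by
  unfold pickCW at h
  split_ifs at h with hne
  exact fun p hp hap => hne ⟨p, Finset.mem_filter.2 ⟨hp, hap⟩⟩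

/-- The propagator deleted when the algorithm started at `i` processes the vertex `i + t`. -/
noncomputable def gnPick (P : Finset (Prp n)) (i : ZMod n) (t : ℕ) : Option (Prp n) :=
  pickCW n (gnRun n P i t).1 (i + (t : ZMod n))

lemma gnRun_succ_of_none {t : ℕ} (h : gnPick P i t = none) :
    gnRun n P i (t + 1) = gnRun n P i t := by
  unfold gnPick at h
  rw [gnRun, h]

lemma gnRun_succ_of_some {t : ℕ} {q : Prp n} (h : gnPick P i t = some q) :
    gnRun n P i (t + 1) = ((gnRun n P i t).1.erase q,
      Function.update (gnRun n P i t).2 q (some (i + (t : ZMod n)))) := by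
  unfold gnPick at h
  rw [gnRun, h]

lemma mem_gnRun_iff (t : ℕ) (p : Prp n) :
    p ∈ (gnRun n P i t).1 ↔ Remains P (gnPick P i) t p := by
  induction t with
  | zero => simp [gnRun, Remains]
  | succ t ih =>
    have : Remains P (gnPick P i) (t + 1) p ↔
        Remains P (gnPick P i) t p ∧ gnPick P i t ≠ some p := by
      simp only [Remains, Nat.lt_succ_iff_lt_or_eq]
      grind
    rw [this, ← ih]
    rcases h : gnPick P i t with _ | q
    · simp [gnRun_succ_of_none h]
    · rw [gnRun_succ_of_some h, Finset.mem_erase]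
      simp only [ne_eq, Option.some.injEq]
      grind

lemma gnRun_snd_eq_some_iff (t : ℕ) (p : Prp n) (v : ZMod n) :
    (gnRun n P i t).2 p = some v ↔ ∃ u < t, gnPick P i u = some p ∧ v = i + (u : ZMod n) := by
  induction t with
  | zero => simp [gnRun]
  | succ t ih =>
    simp only [Nat.lt_succ_iff_lt_or_eq, or_and_right, exists_or, exists_eq_left, ← ih]
    rcases h : gnPick P i t with _ | q
    · simp [gnRun_succ_of_none h]
    · rw [gnRun_succ_of_some h]
      by_cases hpq : p = q
      · subst hpq
        have hp := (mem_gnRun_iff t p).1 (of_pickCW_eq_some h).1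
        have : ¬ (gnRun n P i t).2 p = some v := by
          rw [ih]
          rintro ⟨u, hu, hup, -⟩
          exact hp.2 u hu hup
        simp [this, eq_comm]
      · simp [Function.update_of_ne hpq, Ne.symm hpq]

lemma mem_gnSet_iff [NeZero n] (v : ZMod n) :
    v ∈ gnSet n P i ↔ ∃ p, gnPick P i (ord n i v) = some p := by
  simp only [gnSet, gnAssign, Finset.mem_filter, Finset.mem_univ, true_and,
    gnRun_snd_eq_some_iff]
  refine exists_congr fun p => ⟨?_, fun h => ⟨_, ord_lt _ _, h, (add_ord i v).symm⟩⟩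
  rintro ⟨u, hu, hup, rfl⟩
  rwa [ord_add_natCast i hu]

lemma linearRun [NeZero n] (hadm : IsAdmissible n P) (i : ZMod n) :
    LinearRun n P (lo i) (hi i) (gnPick P i) := by
  have hmax : ∀ t < n, ∀ q p, gnPick P i t = some q → Remains P (gnPick P i) t p →
      Touches n (lo i) (hi i) p t → cwKey n (i + t) p ≤ cwKey n (i + t) q :=
    fun t ht q p hq hp hpt => (of_pickCW_eq_some hq).2.2 p ((mem_gnRun_iff t p).2 hp)
      ((mem_supp_iff i p ht).2 hpt)
  have hrem : ∀ t < n, ∀ q, gnPick P i t = some q → Remains P (gnPick P i) t q :=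
    fun t _ q hq => (mem_gnRun_iff t q).1 (of_pickCW_eq_some hq).1
  have hpref : ∀ t < n, ∀ q p, gnPick P i t = some q → Remains P (gnPick P i) t p →
      (lo i p = t ∨ hi i p = t) → (lo i q = t ∨ hi i q = t) := by
    intro t ht q p hq hp hpt
    by_contra hqt
    have h1 := hmax t ht q p hq hp (Or.inl hpt)
    have h2 := cwKey_lt_of_not_edge i q ht hqt
    rw [cwKey_of_edge i p ht hpt] at h1
    split_ifs at h1 <;> omega
  refine
    { lt := fun p _ => hi_lt i p
      nonadj := fun p hp => lo_add_one_lt_hi hadm i hp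
      noncross := fun p hp q hq => not_lo_hi_interleave hadm i hp hq
      dense := fun Q hQ hne => (hadm.dense Q hQ hne).trans_eq (card_suppSet i Q)
      of_none := fun t ht h p hp hpt => of_pickCW_eq_none h p ((mem_gnRun_iff t p).2 hp)
        ((mem_supp_iff i p ht).2 hpt)
      remains_of_some := hrem
      touches_of_some := fun t ht q hq => (mem_supp_iff i q ht).1 (of_pickCW_eq_some hq).2.1
      edge_pref := hpref
      left_pref := ?_
      right_pref := ?_ }
  · intro t ht q p hq hp hlr h
    have hp1 := lo_add_one_lt_hi hadm i hp.1
    have hq1 := lo_add_one_lt_hi hadm i (hrem t ht q hq).1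
    have hp2 := hi_lt i p
    have hm := hmax t ht q p hq hp (by unfold Touches; omega)
    rcases h with h | h
    · rw [cwKey_of_edge i p ht (by omega), cwKey_of_edge i q ht (by omega)] at hm
      split_ifs at hm <;> omega
    · rw [cwKey_of_not_edge i p (by omega) (by omega) (by omega),
        cwKey_of_not_edge i q (by omega) (by omega) (by omega)] at hm
      split_ifs at hm <;> omega
  · intro t ht q p hq hp h h'
    have hp1 := lo_add_one_lt_hi hadm i hp.1
    have hq1 := lo_add_one_lt_hi hadm i (hrem t ht q hq).1
    have hp2 := hi_lt i p
    have hq2 := hi_lt i q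
    have hm := hmax t ht q p hq hp (by unfold Touches; omega)
    rcases h with h | ⟨h, hqt⟩
    · rw [cwKey_of_edge i p ht (by omega), cwKey_of_edge i q ht (by omega)] at hm
      split_ifs at hm <;> omega
    · have hpt : ¬ (lo i p = t ∨ hi i p = t) := by omega
      rw [cwKey_of_not_edge i p (by omega) (by omega) (by omega),
        cwKey_of_not_edge i q (by omega) (by omega) (by omega)] at hm
      split_ifs at hm <;> omega

end Run

section Necklace

variable {n : ℕ} [NeZero n] {P : Finset (Prp n)}

lemma indep_gnSet (hadm : IsAdmissible n P) (i : ZMod n) : Indep n P (gnSet n P i) := by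
  intro U hU
  have h := linearRun hadm i
  choose! f hf using fun v => (mem_gnSet_iff (P := P) (i := i) v).1
  refine Finset.card_le_card_of_injOn f (fun v hv => ?_) fun v hv w hw hvw => ?_
  · refine Finset.mem_filter.2 ⟨(h.remains_of_some _ (ord_lt i v) _ (hf v (hU hv))).1, v, ?_⟩
    have := h.touches_of_some _ (ord_lt i v) _ (hf v (hU hv))
    rw [← mem_supp_iff i _ (ord_lt i v), add_ord] at this
    exact Finset.mem_inter.2 ⟨this, hv⟩
  · exact ord_injective i (h.eq_of_some (ord_lt i v) (ord_lt i w) (hf v (hU hv))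
      (hvw ▸ hf w (hU hw)))

lemma card_gnSet (hadm : IsAdmissible n P) (i : ZMod n) : (gnSet n P i).card = P.card := by
  refine le_antisymm ?_ ?_
  · exact (indep_gnSet hadm i _ subset_rfl).trans (Finset.card_filter_le _ _)
  · have h := linearRun hadm i
    choose! f hf using fun p => h.exists_pick (p := p)
    refine Finset.card_le_card_of_injOn (fun p => i + (f p : ZMod n)) (fun p hp => ?_)
      fun p hp q hq hpq => ?_
    · refine (mem_gnSet_iff _).2 ⟨p, ?_⟩
      rw [ord_add_natCast i (hf p hp).1]
      exact (hf p hp).2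
    · have := congrArg (ord n i) hpq
      simp only [ord_add_natCast i (hf p hp).1, ord_add_natCast i (hf q hq).1] at this
      have hp' := (hf p hp).2
      rw [this, (hf q hq).2] at hp'
      exact (Option.some.inj hp').symm

lemma not_indep_of_lexLt (hadm : IsAdmissible n P) {i : ZMod n} {J : Finset (ZMod n)}
    (hJ : LexLt n i J (gnSet n P i)) : ¬ Indep n P J := by
  obtain ⟨v, hvJ, hvI, hv⟩ := hJ
  have h := linearRun hadm i
  have hnone : gnPick P i (ord n i v) = none := by
    rw [← Option.not_isSome_iff_eq_none, Option.isSome_iff_exists, ← mem_gnSet_iff]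
    exact hvI
  obtain ⟨s, hsv, hs⟩ := h.exists_blocked (ord_lt i v) (fun d _ => h.not_remains d) hnone
  set U := J.filter fun w => s ≤ ord n i w ∧ ord n i w ≤ ord n i v
  have hvU : v ∈ U := Finset.mem_filter.2 ⟨hvJ, hsv, le_rfl⟩
  have key : ∀ p ∈ propsOn n P U, ∃ w ∈ U.erase v, gnPick P i (ord n i w) = some p := by
    intro p hp
    obtain ⟨hpP, w, hw⟩ := Finset.mem_filter.1 hp
    obtain ⟨hwp, hwU⟩ := Finset.mem_inter.1 hw
    obtain ⟨-, hsw, hwv⟩ := Finset.mem_filter.1 hwU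
    rw [← add_ord i w, mem_supp_iff i p (ord_lt i w)] at hwp
    obtain ⟨u, hsu, huv, hu⟩ := hs _ hsw hwv p hpP hwp
    have hun := huv.trans (ord_lt i v)
    refine ⟨i + u, Finset.mem_erase.2 ⟨?_, Finset.mem_filter.2 ⟨(hv _ ?_).2 ?_, ?_⟩⟩, ?_⟩
    · rintro rfl
      rw [ord_add_natCast i hun] at huv
      exact lt_irrefl _ huv
    · rwa [ord_add_natCast i hun]
    · rw [mem_gnSet_iff, ord_add_natCast i hun]
      exact ⟨p, hu⟩
    · rw [ord_add_natCast i hun]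
      exact ⟨hsu, huv.le⟩
    · rwa [ord_add_natCast i hun]
  intro hind
  have h1 := hind U (Finset.filter_subset _ _)
  have h2 : (propsOn n P U).card ≤ (U.erase v).card := by
    choose! f hf using key
    refine Finset.card_le_card_of_injOn f (fun p hp => (hf p hp).1) fun p hp q hq hpq => ?_
    have := (hf p hp).2
    rw [hpq, (hf q hq).2] at this
    exact (Option.some.inj this).symm
  have h3 := Finset.card_erase_lt_of_mem hvU
  omega

end Necklace

end WLD

namespace WLD

/-- the algorithm produces the Grassmann necklace of `M(W)`.
Let `W` be an admissible Wilson loop diagram with `k` propagators and `n`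
vertices.  The Grassmann necklace `(I_1^W, …, I_n^W)` produced by the Grassmann
necklace algorithm is the Grassmann necklace of the positroid `M(W)`: for each
`i ∈ [n]` the set `I_i^W` is a basis of `M(W)`, and every `k`-subset of `[n]`
that is strictly smaller than `I_i^W` in the lexicographic order induced by
`<_i` is a dependent set of `M(W)`. -/
theorem gnSet_is_necklace_of_positroid
    (n : ℕ) [NeZero n] (P : Finset (Prp n)) (hadm : IsAdmissible n P) :
    ∀ i : ZMod n,
      (Indep n P (gnSet n P i) ∧ (gnSet n P i).card = P.card) ∧
      ∀ J : Finset (ZMod n), J.card = P.card → LexLt n i J (gnSet n P i) →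
        ¬ Indep n P J := by
  exact fun i => ⟨⟨indep_gnSet hadm i, card_gnSet hadm i⟩,
    fun _ _ hlex => not_indep_of_lexLt hadm hlex⟩

end WLD
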